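/- Let X be a measurable space and let D_s and D_t be probability measures on X. For measurable functions f, g : X → ℝ taking values in [0,1], define ε_s(f,g) = ∫ |f − g| dD_s and ε_t(f,g) = ∫ |f − g| dD_t. Let H be a set of measurable functions X → ℝ with values in [0,1] and define d_{HΔH}(D_s, D_t) = 2 · sup_{h,h' ∈ H} |ε_t(h,h') − ε_s(h,h')|. Let y_s, y_t : X → ℝ be measurable with values in [0,1]. Then for every h ∈ H and every h* ∈ H, |ε_s(h, y_s) − ε_t(h, y_t)| ≤ ε_s(h*, y_s) + ε_t(h*, y_t) + (1/2) · d_{HΔH}(D_s, D_t). -/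

import Mathlib

open MeasureTheory

theorem abs_sub_mem_Icc_zero_one {a b : ℝ} (ha : a ∈ Set.Icc (0 : ℝ) 1)
    (hb : b ∈ Set.Icc (0 : ℝ) 1) : |a - b| ∈ Set.Icc (0 : ℝ) 1 :=
  ⟨abs_nonneg _, abs_le.2 ⟨by linarith [ha.1, hb.2], by linarith [ha.2, hb.1]⟩⟩

section

variable {X : Type*} [MeasurableSpace X] (μ : Measure X) [IsProbabilityMeasure μ] {f g k : X → ℝ}

theorem integrable_abs_sub_of_mem_Icc (hf : Measurable f) (hg : Measurable g)
    (hf01 : ∀ x, f x ∈ Set.Icc (0 : ℝ) 1) (hg01 : ∀ x, g x ∈ Set.Icc (0 : ℝ) 1) :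
    Integrable (fun x => |f x - g x|) μ :=
  Integrable.of_mem_Icc 0 1 (hf.sub hg).abs.aemeasurable
    (ae_of_all _ fun x => abs_sub_mem_Icc_zero_one (hf01 x) (hg01 x))

theorem integral_abs_sub_mem_Icc (hf : Measurable f) (hg : Measurable g)
    (hf01 : ∀ x, f x ∈ Set.Icc (0 : ℝ) 1) (hg01 : ∀ x, g x ∈ Set.Icc (0 : ℝ) 1) :
    ∫ x, |f x - g x| ∂μ ∈ Set.Icc (0 : ℝ) 1 := by
  refine ⟨integral_nonneg fun x => abs_nonneg _, ?_⟩
  simpa using integral_mono (integrable_abs_sub_of_mem_Icc μ hf hg hf01 hg01)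
    (integrable_const (1 : ℝ)) fun x => (abs_sub_mem_Icc_zero_one (hf01 x) (hg01 x)).2

/-- The reverse triangle inequality for the L¹ distance. -/
theorem abs_integral_abs_sub_sub_le (hf : Measurable f) (hg : Measurable g) (hk : Measurable k)
    (hf01 : ∀ x, f x ∈ Set.Icc (0 : ℝ) 1) (hg01 : ∀ x, g x ∈ Set.Icc (0 : ℝ) 1)
    (hk01 : ∀ x, k x ∈ Set.Icc (0 : ℝ) 1) :
    |(∫ x, |f x - k x| ∂μ) - ∫ x, |f x - g x| ∂μ| ≤ ∫ x, |g x - k x| ∂μ := by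
  rw [← integral_sub (integrable_abs_sub_of_mem_Icc μ hf hk hf01 hk01)
    (integrable_abs_sub_of_mem_Icc μ hf hg hf01 hg01)]
  refine abs_integral_le_integral_abs.trans (integral_mono_of_nonneg
    (ae_of_all _ fun x => abs_nonneg _) (integrable_abs_sub_of_mem_Icc μ hg hk hg01 hk01)
    (ae_of_all _ fun x => ?_))
  simpa using abs_abs_sub_abs_le_abs_sub (f x - k x) (f x - g x)

end


/-- For every `h ∈ H` and `h* ∈ H`, the gap between source error with true
source labels and target error with true target labels is bounded by
`ε_s(h*,y_s) + ε_t(h*,y_t) + (1/2)·d_{HΔH}(D_s,D_t)`. -/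
theorem source_target_error_gap
    {X : Type*} [MeasurableSpace X]
    (Ds Dt : Measure X) [IsProbabilityMeasure Ds] [IsProbabilityMeasure Dt]
    (H : Set (X → ℝ))
    (hHmeas : ∀ h ∈ H, Measurable h)
    (hH01 : ∀ h ∈ H, ∀ x, h x ∈ Set.Icc (0 : ℝ) 1)
    (ys yt : X → ℝ)
    (hys : Measurable ys) (hys01 : ∀ x, ys x ∈ Set.Icc (0 : ℝ) 1)
    (hyt : Measurable yt) (hyt01 : ∀ x, yt x ∈ Set.Icc (0 : ℝ) 1)
    (h : X → ℝ) (hh : h ∈ H)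
    (hstar : X → ℝ) (hhstar : hstar ∈ H) :
    |(∫ x, |h x - ys x| ∂Ds) - ∫ x, |h x - yt x| ∂Dt|
      ≤ (∫ x, |hstar x - ys x| ∂Ds) + (∫ x, |hstar x - yt x| ∂Dt)
        + (1 / 2) *
            (2 * sSup {r : ℝ | ∃ h1 ∈ H, ∃ h2 ∈ H,
              r = |(∫ x, |h1 x - h2 x| ∂Dt) - (∫ x, |h1 x - h2 x| ∂Ds)|}) := by
  have hmeas := hHmeas h hh
  have h01 := hH01 h hh
  have hsmeas := hHmeas hstar hhstar
  have hs01 := hH01 hstar hhstar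
  have bs := abs_integral_abs_sub_sub_le Ds hmeas hsmeas hys h01 hs01 hys01
  have bt := abs_integral_abs_sub_sub_le Dt hmeas hsmeas hyt h01 hs01 hyt01
  have hbdd : BddAbove {r : ℝ | ∃ h1 ∈ H, ∃ h2 ∈ H,
      r = |(∫ x, |h1 x - h2 x| ∂Dt) - (∫ x, |h1 x - h2 x| ∂Ds)|} := by
    refine ⟨1, ?_⟩
    rintro r ⟨h1, hh1, h2, hh2, rfl⟩
    have key (μ : Measure X) [IsProbabilityMeasure μ] :=
      integral_abs_sub_mem_Icc μ (hHmeas h1 hh1) (hHmeas h2 hh2) (hH01 h1 hh1) (hH01 h2 hh2)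
    exact (abs_sub_mem_Icc_zero_one (key Dt) (key Ds)).2
  have hsup := le_csSup hbdd ⟨h, hh, hstar, hhstar, rfl⟩
  rw [abs_le] at bs bt hsup ⊢
  constructor <;> linarith [bs.1, bs.2, bt.1, bt.2, hsup.1, hsup.2]
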